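/- Let p ∈ (0,∞], R > 0, and let φ₀(x) = π^{−d/4} e^{−|x|²/2} be the Gaussian. Then there exists a constant C > 0, independent of X₀ ∈ ℝ^{2d} and of f, such that |V_{φ₀} f(X₀)| ≤ C ‖V_{φ₀} f‖_{L^p(B_R(X₀))} for all f in the Gelfand–Shilov distribution space Σ₁′(ℝ^d) (in particular for all tempered distributions f), where B_R(X₀) is the open ball of radius R centered at X₀ in ℝ^{2d}. -/

import Mathlib

noncomputable section
open MeasureTheory
open scoped ENNReal NNReal

/-- The standard Gaussian `φ₀(x) = π^{−d/4} e^{−|x|²/2}` on ℝ^d (Euclidean `|x|²`). -/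
def gaussianWindow (d : ℕ) (x : Fin d → ℝ) : ℂ :=
  ((Real.pi ^ (-(d : ℝ) / 4) : ℝ) : ℂ) * Complex.exp (-((∑ i, x i ^ 2 : ℝ) : ℂ) / 2)


theorem aux_sub_norm {q : ℝ} (hq : 0 < q) {H : ℂ → ℂ} (hH : Differentiable ℂ H)
    (h0 : ‖H 0‖ = Real.exp (1 / q)) :
    ‖H 0‖ ^ q ≤ Real.circleAverage (fun z => ‖H z‖ ^ q) 0 1 := by
  have hne : H 0 ≠ 0 := by
    intro h; rw [h, norm_zero] at h0; exact (Real.exp_pos _).ne h0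
  have han : AnalyticOnNhd ℂ H (Metric.closedBall 0 |(1:ℝ)|) :=
    fun z _ => hH.analyticAt z
  have hJ := AnalyticOnNhd.circleAverage_log_norm (R := 1) one_ne_zero han hne
  have hpos : 0 ≤ ∑ᶠ u, (MeromorphicOn.divisor H (Metric.closedBall 0 |(1:ℝ)|) u : ℝ)
      * Real.log (1 * ‖(0:ℂ) - u‖⁻¹) := by
    apply finsum_nonneg
    intro u
    by_cases hu : u ∈ Metric.closedBall (0:ℂ) |(1:ℝ)|
    · apply mul_nonneg
      · exact_mod_cast MeromorphicOn.AnalyticOnNhd.divisor_nonneg han u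
      · simp only [abs_one, Metric.mem_closedBall, dist_zero_right] at hu
        simp only [zero_sub, norm_neg, one_mul, Real.log_inv]
        have := Real.log_nonpos (norm_nonneg u) hu
        linarith
    · rw [Function.locallyFinsuppWithin.apply_eq_zero_of_notMem _ hu]; simp
  have hlog : Real.log ‖H 0‖ ≤ Real.circleAverage (fun z => Real.log ‖H z‖) 0 1 := by
    rw [hJ]; linarith
  have hint1 : CircleIntegrable (fun z => Real.log ‖H z‖) 0 1 :=
    MeromorphicOn.circleIntegrable_log_norm
      (fun z _ => (hH.analyticAt z).meromorphicAt)
  have hint2 : CircleIntegrable (fun z => ‖H z‖ ^ q) 0 1 := by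
    apply ContinuousOn.circleIntegrable (by norm_num)
    exact (hH.continuous.norm.rpow_const (fun _ => Or.inr hq.le)).continuousOn
  have hpt : ∀ z, (Real.exp 1 * q) * Real.log ‖H z‖ ≤ ‖H z‖ ^ q := by
    intro z
    by_cases hz : H z = 0
    · simp [hz, Real.zero_rpow hq.ne']
    · rw [Real.rpow_def_of_pos (norm_pos_iff.2 hz)]
      have := Real.add_one_le_exp (Real.log ‖H z‖ * q - 1)
      rw [Real.exp_sub, le_div_iff₀ (Real.exp_pos _)] at this
      linarith
  have hav : (Real.exp 1 * q) * Real.circleAverage (fun z => Real.log ‖H z‖) 0 1 ≤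
      Real.circleAverage (fun z => ‖H z‖ ^ q) 0 1 := by
    rw [← smul_eq_mul, ← Real.circleAverage_fun_smul]
    apply Real.circleAverage_mono _ hint2
    · intro z _; exact hpt z
    · exact hint1.const_fun_smul
  have h1 : ‖H 0‖ ^ q = (Real.exp 1 * q) * Real.log ‖H 0‖ := by
    rw [h0, Real.log_exp, ← Real.exp_mul, one_div_mul_cancel hq.ne', mul_assoc,
      mul_one_div_cancel hq.ne', mul_one]
  rw [h1]
  refine le_trans ?_ hav
  gcongr

theorem aux_sub {q : ℝ} (hq : 0 < q) {H : ℂ → ℂ} (hH : Differentiable ℂ H) :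
    ‖H 0‖ ^ q ≤ Real.circleAverage (fun z => ‖H z‖ ^ q) 0 1 := by
  by_cases h : H 0 = 0
  · rw [h, norm_zero, Real.zero_rpow hq.ne']
    apply Real.circleAverage_nonneg_of_nonneg
    intro z _; positivity
  have h' := norm_pos_iff.2 h
  set c : ℝ := Real.exp (1 / q) / ‖H 0‖ with hc
  have hc0 : 0 < c := by positivity
  have := aux_sub_norm hq (H := fun z => (c : ℂ) * H z) (hH.const_mul _)
    (by simp only [norm_mul, Complex.norm_real, Real.norm_eq_abs, abs_of_pos hc0]
        rw [hc]; field_simp)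
  simp only [norm_mul, Complex.norm_real, Real.norm_eq_abs, abs_of_pos hc0,
    Real.mul_rpow hc0.le (norm_nonneg _)] at this
  simp only [← smul_eq_mul, Real.circleAverage_fun_smul] at this
  simp only [smul_eq_mul] at this
  exact le_of_mul_le_mul_left this (by positivity)

theorem aux_sub_lint {q : ℝ} (hq : 0 < q) {H : ℂ → ℂ} (hH : Differentiable ℂ H) :
    ‖H 0‖ₑ ^ q * ENNReal.ofReal (2 * Real.pi) ≤
      ∫⁻ θ in Set.Ioc 0 (2 * Real.pi), ‖H (Complex.exp (θ * Complex.I))‖ₑ ^ q := by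
  have h := aux_sub hq hH
  have hcont : Continuous (fun θ : ℝ => ‖H (Complex.exp (θ * Complex.I))‖ ^ q) :=
    (hH.continuous.comp (by fun_prop)).norm.rpow_const (fun _ => Or.inr hq.le)
  have e : ∀ z, ‖H z‖ₑ ^ q = ENNReal.ofReal (‖H z‖ ^ q) := by
    intro z
    rw [← ofReal_norm, ENNReal.ofReal_rpow_of_nonneg (norm_nonneg _) hq.le]
  simp only [e]
  rw [← ofReal_integral_eq_lintegral_ofReal
      (hcont.integrableOn_Ioc) (Filter.Eventually.of_forall fun _ => by positivity),
    ← ENNReal.ofReal_mul (by positivity)]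
  apply ENNReal.ofReal_le_ofReal
  rw [Real.circleAverage_def, intervalIntegral.integral_of_le (by positivity)] at h
  simp only [circleMap_zero, Complex.ofReal_one, one_mul, smul_eq_mul] at h
  rw [inv_mul_eq_div, le_div_iff₀ (by positivity)] at h
  exact h

theorem aux_rot (d : ℕ) (c : ℂ) (hc : ‖c‖ = 1) :
    MeasurePreserving (fun v : Fin d → ℂ => fun i => c * v i) := by
  apply volume_preserving_pi
  intro i
  have := (rotation (⟨c, by simp [Submonoid.unitSphere, hc]⟩ : Circle)).measurePreserving
  have e : (fun v : ℂ => c * v) =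
      rotation (⟨c, by simp [Submonoid.unitSphere, hc]⟩ : Circle) := by
    funext v; rfl
  change MeasurePreserving (fun v : ℂ => c * v) _ _
  rw [e]
  exact this

/-- sub-mean value property on polydiscs -/
theorem aux_mean {d : ℕ} {q : ℝ} (hq : 0 < q) {H : (Fin d → ℂ) → ℂ} (hH : Differentiable ℂ H)
    (w : Fin d → ℂ) (R : ℝ) :
    ‖H w‖ₑ ^ q * volume (Metric.ball (0 : Fin d → ℂ) R) ≤
      ∫⁻ v in Metric.ball (0 : Fin d → ℂ) R, ‖H (w + v)‖ₑ ^ q := by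
  set B := Metric.ball (0 : Fin d → ℂ) R
  set T := Set.Ioc 0 (2 * Real.pi)
  have hH' := hH.continuous
  have h1 : ∀ v : Fin d → ℂ, ‖H w‖ₑ ^ q * ENNReal.ofReal (2 * Real.pi) ≤
      ∫⁻ θ in T, ‖H (w + Complex.exp ((θ : ℝ) * Complex.I) • v)‖ₑ ^ q := by
    intro v
    have := aux_sub_lint hq (H := fun t : ℂ => H (w + t • v))
      (hH.comp (by fun_prop))
    simpa using this
  have h2 : ∀ θ : ℝ, ∫⁻ v in B, ‖H (w + Complex.exp ((θ : ℝ) * Complex.I) • v)‖ₑ ^ q =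
      ∫⁻ v in B, ‖H (w + v)‖ₑ ^ q := by
    intro θ
    have hn : ‖Complex.exp ((θ : ℝ) * Complex.I)‖ = 1 := Complex.norm_exp_ofReal_mul_I θ
    have hmp := aux_rot d _ hn
    have := (hmp.restrict_preimage (s := B) Metric.isOpen_ball.measurableSet).lintegral_comp
      (f := fun v => ‖H (w + v)‖ₑ ^ q)
      ((hH'.comp (by fun_prop : Continuous fun v => w + v)).measurable.enorm.pow_const q)
    rw [← this]
    have hB : (fun v : Fin d → ℂ => fun i => Complex.exp ((θ : ℝ) * Complex.I) * v i) ⁻¹' B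
        = B := by
      ext v
      have : (fun i => Complex.exp ((θ : ℝ) * Complex.I) * v i) =
        Complex.exp ((θ : ℝ) * Complex.I) • v := rfl
      simp only [B, Set.mem_preimage, Metric.mem_ball, dist_zero_right, this, norm_smul, hn,
        one_mul]
    rw [hB]
    rfl
  have h3 : ∫⁻ v in B, ‖H w‖ₑ ^ q * ENNReal.ofReal (2 * Real.pi) ≤
      ∫⁻ v in B, ∫⁻ θ in T, ‖H (w + Complex.exp ((θ : ℝ) * Complex.I) • v)‖ₑ ^ q :=
    lintegral_mono h1
  rw [lintegral_lintegral_swap (by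
    apply Measurable.aemeasurable
    have : Continuous (fun p : (Fin d → ℂ) × ℝ =>
        H (w + Complex.exp ((p.2 : ℝ) * Complex.I) • p.1)) := hH'.comp (by fun_prop)
    exact this.measurable.enorm.pow_const q)] at h3
  simp only [h2] at h3
  simp only [lintegral_const, Measure.restrict_apply_univ] at h3
  have hT : volume T = ENNReal.ofReal (2 * Real.pi) := by simp [T]
  rw [hT, mul_right_comm] at h3
  exact (ENNReal.mul_le_mul_iff_left (by simp [Real.pi_pos]) ENNReal.ofReal_ne_top).1 h3

theorem iter_succ_le {g g' : ℂ → ℂ} (h : ∀ z, HasDerivAt g (g' z) z)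
    (hg' : ContDiff ℝ ⊤ g') (n : ℕ) (z : ℂ) :
    ‖iteratedFDeriv ℝ (n + 1) g z‖ ≤ ‖iteratedFDeriv ℝ n g' z‖ := by
  have e : fderiv ℝ g = (ContinuousLinearMap.mul ℝ ℂ) ∘ g' := by
    funext z
    rw [((h z).hasFDerivAt.restrictScalars ℝ).fderiv]
    ext; simp [mul_comm]
  rw [← norm_iteratedFDeriv_fderiv, e]
  refine ((ContinuousLinearMap.mul ℝ ℂ).norm_iteratedFDeriv_comp_left (N := ⊤) hg'.contDiffAt
    (by exact_mod_cast le_top)).trans ?_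
  calc _ ≤ 1 * ‖iteratedFDeriv ℝ n g' z‖ := by
        gcongr; exact ContinuousLinearMap.opNorm_mul_le ℝ ℂ
    _ = _ := one_mul _

theorem iter_exp_le (h : ℂ) (n : ℕ) : ∀ (c z : ℂ),
    ‖iteratedFDeriv ℝ n (fun z => c * Complex.exp (h * z)) z‖ ≤
      ‖c‖ * ‖h‖ ^ n * ‖Complex.exp (h * z)‖ := by
  induction n with
  | zero => intro c z; simp
  | succ n ih =>
    intro c z
    have hd : ∀ z, HasDerivAt (fun z => c * Complex.exp (h * z))
        ((fun z => (c * h) * Complex.exp (h * z)) z) z := by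
      intro z
      have := (((hasDerivAt_id' z).const_mul h).cexp).const_mul c
      refine this.congr_deriv ?_
      ring
    refine (iter_succ_le hd (by fun_prop) n z).trans ((ih (c * h) z).trans ?_)
    rw [norm_mul, pow_succ]
    apply le_of_eq; ring

theorem iter_exp1_le (n : ℕ) (z : ℂ) :
    ‖iteratedFDeriv ℝ n Complex.exp z‖ ≤ ‖Complex.exp z‖ := by
  simpa using iter_exp_le 1 n 1 z

theorem exp_bd2 (r : ℝ) (hr : 0 ≤ r) : r ^ 2 * Real.exp r ≤ 2 * Real.exp (2 * r) := by
  have := Real.pow_div_factorial_le_exp r hr 2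
  have h2 : Real.exp (2 * r) = Real.exp r * Real.exp r := by rw [two_mul, Real.exp_add]
  have : r ^ 2 ≤ 2 * Real.exp r := by norm_num at this; linarith
  rw [h2]; nlinarith [Real.exp_pos r]

theorem exp_bd1 (r : ℝ) (hr : 0 ≤ r) : r * Real.exp r ≤ 2 * Real.exp (2 * r) := by
  have := Real.add_one_le_exp r
  have h2 : Real.exp (2 * r) = Real.exp r * Real.exp r := by rw [two_mul, Real.exp_add]
  rw [h2]; nlinarith [Real.exp_pos r]

theorem exp_bd0 (r : ℝ) (hr : 0 ≤ r) : Real.exp r ≤ 2 * Real.exp (2 * r) := by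
  have := Real.add_one_le_exp r
  have h2 : Real.exp (2 * r) = Real.exp r * Real.exp r := by rw [two_mul, Real.exp_add]
  rw [h2]; nlinarith [Real.exp_pos r]

theorem norm_exp_le' (h z : ℂ) (hh : ‖h‖ ≤ 1) : ‖Complex.exp (h * z)‖ ≤ Real.exp ‖z‖ := by
  refine (Complex.norm_exp_le_exp_norm _).trans ?_
  apply Real.exp_le_exp.2
  rw [norm_mul]
  exact mul_le_of_le_one_left (norm_nonneg _) hh

theorem iter_g_le (h : ℂ) (hh : ‖h‖ ≤ 1) (n : ℕ) (z : ℂ) :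
    ‖iteratedFDeriv ℝ n (fun z => Complex.exp (h * z) - 1 - h * z) z‖ ≤
      ‖h‖ ^ 2 * (2 * Real.exp (2 * ‖z‖)) := by
  have hz := norm_nonneg z
  have hh0 := norm_nonneg h
  have hE := norm_exp_le' h z hh
  have hE' : Real.exp ‖h * z‖ ≤ Real.exp ‖z‖ := by
    apply Real.exp_le_exp.2
    rw [norm_mul]; exact mul_le_of_le_one_left (norm_nonneg _) hh
  have hd1 : ∀ z, HasDerivAt (fun z => Complex.exp (h * z) - 1 - h * z)
        ((fun z => h * Complex.exp (h * z) - h) z) z := by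
    intro z
    have h1 := ((hasDerivAt_id' z).const_mul h)
    have := (h1.cexp.sub_const 1).sub h1
    refine this.congr_deriv ?_
    ring
  have hd2 : ∀ z, HasDerivAt (fun z => h * Complex.exp (h * z) - h)
        ((fun z => (h * h) * Complex.exp (h * z)) z) z := by
    intro z
    have h1 := ((hasDerivAt_id' z).const_mul h)
    have := (h1.cexp.const_mul h).sub_const h
    refine this.congr_deriv ?_
    ring
  match n with
  | 0 =>
    rw [norm_iteratedFDeriv_zero]
    have := Complex.norm_exp_sub_sum_le_norm_mul_exp (h * z) 2
    simp only [Finset.sum_range_succ, Finset.sum_range_zero] at this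
    norm_num at this
    rw [← sub_sub] at this
    calc _ ≤ _ := this
      _ = ‖h‖ ^ 2 * (‖z‖ ^ 2 * Real.exp (‖h‖ * ‖z‖)) := by ring
      _ ≤ ‖h‖ ^ 2 * (‖z‖ ^ 2 * Real.exp ‖z‖) := by
        rw [norm_mul] at hE'; gcongr
      _ ≤ _ := mul_le_mul_of_nonneg_left (exp_bd2 _ hz) (by positivity)
  | 1 =>
    refine (iter_succ_le hd1 (by fun_prop) 0 z).trans ?_
    rw [norm_iteratedFDeriv_zero]
    have := Complex.norm_exp_sub_sum_le_norm_mul_exp (h * z) 1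
    simp only [Finset.sum_range_succ, Finset.sum_range_zero] at this
    norm_num at this
    calc ‖h * Complex.exp (h * z) - h‖ = ‖h‖ * ‖Complex.exp (h * z) - 1‖ := by
          rw [← norm_mul]; ring_nf
      _ ≤ ‖h‖ * (‖h‖ * ‖z‖ * Real.exp (‖h‖ * ‖z‖)) := by gcongr
      _ = ‖h‖ ^ 2 * (‖z‖ * Real.exp (‖h‖ * ‖z‖)) := by ring
      _ ≤ ‖h‖ ^ 2 * (‖z‖ * Real.exp ‖z‖) := by
        rw [norm_mul] at hE'; gcongr
      _ ≤ _ := mul_le_mul_of_nonneg_left (exp_bd1 _ hz) (by positivity)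
  | n + 2 =>
    refine (iter_succ_le hd1 (by fun_prop) (n + 1) z).trans ?_
    refine (iter_succ_le hd2 (by fun_prop) n z).trans ?_
    refine (iter_exp_le h n (h * h) z).trans ?_
    calc ‖h * h‖ * ‖h‖ ^ n * ‖Complex.exp (h * z)‖
        ≤ ‖h * h‖ * 1 * Real.exp ‖z‖ := by gcongr; exact pow_le_one₀ hh0 hh
      _ = ‖h‖ ^ 2 * Real.exp ‖z‖ := by rw [norm_mul]; ring
      _ ≤ _ := by gcongr; exact exp_bd0 _ hz

/-- `y ↦ b · y` -/
def linL {d : ℕ} (b : Fin d → ℂ) : (Fin d → ℝ) →L[ℝ] ℂ :=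
  ∑ i, (b i) • (Complex.ofRealCLM.comp (ContinuousLinearMap.proj i))

theorem linL_apply {d : ℕ} (b : Fin d → ℂ) (y : Fin d → ℝ) :
    linL b y = ∑ i, b i * (y i : ℂ) := by
  simp [linL]

theorem linL_le {d : ℕ} (b : Fin d → ℂ) (y : Fin d → ℝ) :
    ‖linL b y‖ ≤ (d * ‖b‖) * ‖y‖ := by
  rw [linL_apply]
  refine (norm_sum_le _ _).trans ?_
  calc ∑ i, ‖b i * (y i : ℂ)‖ ≤ ∑ i : Fin d, ‖b‖ * ‖y‖ := by
        apply Finset.sum_le_sum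
        intro i _
        rw [norm_mul, Complex.norm_real]
        gcongr
        · exact norm_le_pi_norm b i
        · exact norm_le_pi_norm y i
    _ = _ := by simp; ring

theorem linL_norm {d : ℕ} (b : Fin d → ℂ) : ‖linL b‖ ≤ d * ‖b‖ :=
  ContinuousLinearMap.opNorm_le_bound _ (by positivity) (linL_le b)

def quad {d : ℕ} (a : Fin d → ℂ) (y : Fin d → ℝ) : ℂ :=
  -((∑ i, y i ^ 2 : ℝ) : ℂ) / 2 + linL a y

theorem quad_tg {d : ℕ} (a : Fin d → ℂ) : (quad a).HasTemperateGrowth := by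
  have h1 : (fun y : Fin d → ℝ => linL a y).HasTemperateGrowth := (linL a).hasTemperateGrowth
  have hi : ∀ i, (fun y : Fin d → ℝ => (y i : ℂ)).HasTemperateGrowth := fun i =>
    (Complex.ofRealCLM.comp (ContinuousLinearMap.proj i :
      (Fin d → ℝ) →L[ℝ] ℝ)).hasTemperateGrowth
  have h2 : (fun y : Fin d → ℝ => ∑ i, (y i : ℂ) ^ 2).HasTemperateGrowth := by
    apply Function.HasTemperateGrowth.sum
    intro i _
    exact (hi i).pow 2
  have h3 := ((Function.HasTemperateGrowth.const (E := Fin d → ℝ) (-1/2 : ℂ)).mul h2).add h1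
  have e : quad a = ((fun _ => (-1/2 : ℂ)) * fun y : Fin d → ℝ => ∑ i, (y i : ℂ) ^ 2) +
      fun y => linL a y := by
    funext y
    simp [quad]; ring
  rw [e]
  exact h3

theorem quad_re {d : ℕ} (a : Fin d → ℂ) (y : Fin d → ℝ) :
    (quad a y).re ≤ -‖y‖ ^ 2 / 2 + (d * ‖a‖) * ‖y‖ := by
  have h1 : (linL a y).re ≤ (d * ‖a‖) * ‖y‖ :=
    (Complex.re_le_norm _).trans (linL_le a y)
  have h2 : ‖y‖ ^ 2 ≤ ∑ i, y i ^ 2 := by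
    have h0 : 0 ≤ ∑ i, y i ^ 2 := Finset.sum_nonneg fun i _ => sq_nonneg _
    rw [← Real.le_sqrt (norm_nonneg _) h0, pi_norm_le_iff_of_nonneg (Real.sqrt_nonneg _)]
    intro i
    rw [Real.le_sqrt (norm_nonneg _) h0, Real.norm_eq_abs, sq_abs]
    exact Finset.single_le_sum (f := fun i => y i ^ 2) (fun i _ => sq_nonneg _)
      (Finset.mem_univ i)
  have h3 : (quad a y).re = -(∑ i, y i ^ 2) / 2 + (linL a y).re := by
    rw [quad, Complex.add_re]
    congr 1
    rw [show (-((∑ i, y i ^ 2 : ℝ) : ℂ) / 2) = ((-(∑ i, y i ^ 2) / 2 : ℝ) : ℂ) by push_cast; rfl,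
      Complex.ofReal_re]
  rw [h3]; linarith

theorem gauss_decay {d : ℕ} (a : Fin d → ℂ) (n : ℕ) (c : ℝ) :
    ∃ C : ℝ, 0 ≤ C ∧ ∀ y, Real.exp (c * ‖y‖) *
      ‖iteratedFDeriv ℝ n (fun y => Complex.exp (quad a y)) y‖ ≤ C := by
  obtain ⟨k, C, hC, hb⟩ := (quad_tg a).norm_iteratedFDeriv_le_uniform n
  set K : ℝ := d * ‖a‖
  set M : ℝ := c + K + 1
  refine ⟨(n.factorial * (C + 1) ^ n * (k * n).factorial * Real.exp 1) * Real.exp (M ^ 2 / 2),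
    by positivity, ?_⟩
  intro y
  set r := ‖y‖
  have hr : 0 ≤ r := norm_nonneg y
  have h1 : ‖iteratedFDeriv ℝ n (Complex.exp ∘ quad a) y‖ ≤
      n.factorial * ‖Complex.exp (quad a y)‖ * ((C + 1) * (1 + r) ^ k) ^ n := by
    apply norm_iteratedFDeriv_comp_le (N := (⊤ : ℕ∞)) (Complex.contDiff_exp (𝕜 := ℝ))
      (quad_tg a).1 (by exact_mod_cast le_top)
    · intro i _; exact iter_exp1_le i _
    · intro i hi1 hi
      have hD : 1 ≤ (C + 1) * (1 + r) ^ k := by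
        have : 1 ≤ (1 + r) ^ k := one_le_pow₀ (by linarith)
        nlinarith
      calc _ ≤ C * (1 + r) ^ k := hb i hi y
        _ ≤ (C + 1) * (1 + r) ^ k := by gcongr; linarith
        _ ≤ _ := le_self_pow₀ hD (by omega)
  have h2 : (1 + r) ^ (k * n) ≤ (k * n).factorial * (Real.exp 1 * Real.exp r) := by
    have := Real.pow_div_factorial_le_exp (1 + r) (by linarith) (k * n)
    rw [div_le_iff₀ (by positivity), Real.exp_add] at this
    linarith
  have h3 : ‖Complex.exp (quad a y)‖ ≤ Real.exp (-r ^ 2 / 2 + K * r) := by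
    rw [Complex.norm_exp]; exact Real.exp_le_exp.2 (quad_re a y)
  calc _ ≤ Real.exp (c * r) *
        (n.factorial * Real.exp (-r ^ 2 / 2 + K * r) *
          ((C + 1) ^ n * ((k * n).factorial * (Real.exp 1 * Real.exp r)))) := by
        gcongr
        refine h1.trans ?_
        rw [mul_pow, ← pow_mul]
        gcongr
    _ = (n.factorial * (C + 1) ^ n * (k * n).factorial * Real.exp 1) *
        (Real.exp (c * r) * Real.exp (-r ^ 2 / 2 + K * r) * Real.exp r) := by ring
    _ ≤ _ := by
      gcongr
      rw [← Real.exp_add, ← Real.exp_add]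
      apply Real.exp_le_exp.2
      nlinarith [sq_nonneg (r - M)]

theorem pow_le_exp (k : ℕ) (r : ℝ) (hr : 0 ≤ r) : r ^ k ≤ k.factorial * Real.exp r := by
  have := Real.pow_div_factorial_le_exp r hr k
  rw [div_le_iff₀ (by positivity)] at this
  linarith

/-- the Gaussian exponential as Schwartz function -/
def gS {d : ℕ} (a : Fin d → ℂ) : SchwartzMap (Fin d → ℝ) ℂ where
  toFun y := Complex.exp (quad a y)
  smooth' := (Complex.contDiff_exp (𝕜 := ℝ)).comp (quad_tg a).1
  decay' k n := by
    obtain ⟨C, hC, h⟩ := gauss_decay a n 1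
    refine ⟨k.factorial * C, fun y => ?_⟩
    calc _ ≤ (k.factorial * Real.exp ‖y‖) *
          ‖iteratedFDeriv ℝ n (fun y => Complex.exp (quad a y)) y‖ := by
          gcongr; exact pow_le_exp k _ (norm_nonneg _)
      _ = k.factorial * (Real.exp (1 * ‖y‖) *
          ‖iteratedFDeriv ℝ n (fun y => Complex.exp (quad a y)) y‖) := by rw [one_mul]; ring
      _ ≤ _ := by gcongr; exact h y

theorem gS_apply {d : ℕ} (a : Fin d → ℂ) (y) : gS a y = Complex.exp (quad a y) := rfl

theorem quad_add {d : ℕ} (a b : Fin d → ℂ) (y) : quad (a + b) y = quad a y + linL b y := by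
  simp only [quad, linL_apply, Pi.add_apply, add_mul, Finset.sum_add_distrib]; ring

theorem coord_tg {d : ℕ} (i : Fin d) :
    (fun y : Fin d → ℝ => (y i : ℂ)).HasTemperateGrowth :=
  (Complex.ofRealCLM.comp (ContinuousLinearMap.proj i :
      (Fin d → ℝ) →L[ℝ] ℝ)).hasTemperateGrowth

def gD {d : ℕ} (a : Fin d → ℂ) (i : Fin d) : SchwartzMap (Fin d → ℝ) ℂ :=
  SchwartzMap.smulLeftCLM ℂ (fun y : Fin d → ℝ => (y i : ℂ)) (gS a)

theorem rem_bound {d : ℕ} (a : Fin d → ℂ) (k n : ℕ) :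
    ∃ C : ℝ, 0 ≤ C ∧ ∀ (h : ℂ) (u : Fin d → ℂ), ‖h‖ ≤ 1 → ‖u‖ ≤ 1 →
      SchwartzMap.seminorm ℂ k n (gS (a + h • u) - gS a - ∑ i, (h * u i) • gD a i) ≤
        C * ‖h‖ ^ 2 := by
  choose A hA0 hA using fun m => gauss_decay a m (2 * d + 1)
  refine ⟨∑ i ∈ Finset.range (n + 1), (n.choose i : ℝ) * (2 * (d : ℝ) ^ i) *
    (k.factorial * A (n - i)),
    Finset.sum_nonneg fun i _ => by have := hA0 (n - i); positivity, ?_⟩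
  intro h u hh hu
  apply SchwartzMap.seminorm_le_bound
  · apply mul_nonneg _ (by positivity)
    exact Finset.sum_nonneg fun i _ => by have := hA0 (n - i); positivity
  intro y
  set g : ℂ → ℂ := fun z => Complex.exp (h * z) - 1 - h * z with hg
  have e : (⇑(gS (a + h • u) - gS a - ∑ i, (h * u i) • gD a i) : (Fin d → ℝ) → ℂ) =
      fun y => (g ∘ linL u) y * Complex.exp (quad a y) := by
    funext y
    have hl : linL (h • u) y = h * linL u y := by
      simp [linL_apply, Finset.mul_sum, mul_assoc]
    simp only [sub_apply, gS_apply, quad_add, Complex.exp_add, hl, hg,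
      Function.comp_apply, sum_apply, smul_apply, gD,
      SchwartzMap.smulLeftCLM_apply_apply (coord_tg _), smul_eq_mul]
    rw [linL_apply]
    have : ∑ i, h * u i * ((y i : ℂ) * Complex.exp (quad a y)) =
        h * (∑ i, u i * (y i : ℂ)) * Complex.exp (quad a y) := by
      rw [Finset.mul_sum, Finset.sum_mul]
      exact Finset.sum_congr rfl fun i _ => by ring
    rw [this]; ring
  rw [e]
  have hgc : ContDiff ℝ (⊤ : ℕ∞) g := by fun_prop
  have hgl : ContDiff ℝ (⊤ : ℕ∞) (g ∘ linL u) := hgc.comp (linL u).contDiff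
  have hq : ContDiff ℝ (⊤ : ℕ∞) (fun y => Complex.exp (quad a y)) :=
    (Complex.contDiff_exp (𝕜 := ℝ)).comp (quad_tg a).1
  have hLu : ‖linL u‖ ≤ d := (linL_norm u).trans (mul_le_of_le_one_right (by positivity) hu)
  have hgi : ∀ i, ‖iteratedFDeriv ℝ i (g ∘ linL u) y‖ ≤
      ‖h‖ ^ 2 * (2 * Real.exp (2 * d * ‖y‖)) * d ^ i := by
    intro i
    rw [(linL u).iteratedFDeriv_comp_right hgc y (by exact_mod_cast le_top)]
    refine (ContinuousMultilinearMap.norm_compContinuousLinearMap_le _ _).trans ?_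
    rw [Finset.prod_const, Finset.card_univ, Fintype.card_fin]
    have h1 := iter_g_le h hh i (linL u y)
    have h2 : ‖linL u y‖ ≤ d * ‖y‖ := (linL u).le_of_opNorm_le hLu y
    have h3 : Real.exp (2 * ‖linL u y‖) ≤ Real.exp (2 * d * ‖y‖) :=
      Real.exp_le_exp.2 (by linarith)
    gcongr
    exact h1.trans (by gcongr)
  calc ‖y‖ ^ k * ‖iteratedFDeriv ℝ n (fun y => (g ∘ linL u) y * Complex.exp (quad a y)) y‖
      ≤ (k.factorial * Real.exp ‖y‖) * ∑ i ∈ Finset.range (n + 1), (n.choose i : ℝ) *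
        ‖iteratedFDeriv ℝ i (g ∘ linL u) y‖ *
        ‖iteratedFDeriv ℝ (n - i) (fun y => Complex.exp (quad a y)) y‖ := by
        gcongr
        · exact pow_le_exp k _ (norm_nonneg _)
        · exact norm_iteratedFDeriv_mul_le hgl hq y (by exact_mod_cast le_top)
    _ ≤ _ := by
        rw [Finset.mul_sum, Finset.sum_mul]
        apply Finset.sum_le_sum
        intro i _
        have hE : Real.exp ((2 * d + 1) * ‖y‖) = Real.exp (2 * d * ‖y‖) * Real.exp ‖y‖ := by
          rw [← Real.exp_add]; ring_nf
        have hAi := hA (n - i) y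
        rw [hE] at hAi
        calc _ ≤ (k.factorial * Real.exp ‖y‖) * ((n.choose i : ℝ) *
              (‖h‖ ^ 2 * (2 * Real.exp (2 * d * ‖y‖)) * d ^ i) *
              ‖iteratedFDeriv ℝ (n - i) (fun y => Complex.exp (quad a y)) y‖) := by
              gcongr; exact hgi i
          _ = (n.choose i : ℝ) * (2 * (d : ℝ) ^ i) * (k.factorial *
              (Real.exp (2 * d * ‖y‖) * Real.exp ‖y‖ *
              ‖iteratedFDeriv ℝ (n - i) (fun y => Complex.exp (quad a y)) y‖)) * ‖h‖ ^ 2 := by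
              ring
          _ ≤ _ := by gcongr

theorem F_diff {d : ℕ} (f : SchwartzMap (Fin d → ℝ) ℂ →L[ℂ] ℂ) :
    Differentiable ℂ (fun a : Fin d → ℂ => f (gS a)) := by
  intro a
  obtain ⟨s, C, -, hC⟩ := Seminorm.bound_of_continuous
    (schwartz_withSeminorms ℂ (Fin d → ℝ) ℂ) ((normSeminorm ℂ ℂ).comp f.toLinearMap)
    (by exact (continuous_norm.comp f.continuous))
  choose A hA0 hA using fun m : ℕ × ℕ => rem_bound a m.1 m.2
  set D : (Fin d → ℂ) →L[ℂ] ℂ := ∑ i, (f (gD a i)) • ContinuousLinearMap.proj i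
  have key : ∀ b : Fin d → ℂ, ‖b‖ ≤ 1 →
      ‖f (gS (a + b)) - f (gS a) - D b‖ ≤ (C * ∑ m ∈ s, A m) * ‖b‖ ^ 2 := by
    intro b hb
    obtain ⟨h, u, hh, hu, hbu⟩ : ∃ (h : ℂ) (u : Fin d → ℂ), ‖h‖ = ‖b‖ ∧ ‖u‖ ≤ 1 ∧ b = h • u := by
      by_cases hb0 : b = 0
      · exact ⟨0, 0, by simp [hb0], by simp, by simp [hb0]⟩
      · have hb0' := norm_ne_zero_iff.2 hb0
        refine ⟨(‖b‖ : ℂ), (‖b‖ : ℂ)⁻¹ • b, by simp, ?_, ?_⟩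
        · rw [norm_smul]; simp [hb0']
        · rw [smul_smul, mul_inv_cancel₀ (by exact_mod_cast hb0'), one_smul]
    have e : f (gS (a + b)) - f (gS a) - D b =
        f (gS (a + h • u) - gS a - ∑ i, (h * u i) • gD a i) := by
      have hDb : D b = ∑ i, (h * u i) * f (gD a i) := by
        rw [hbu]
        simp only [D, sum_apply]
        exact Finset.sum_congr rfl fun i _ => by simp; ring
      rw [hDb, hbu]
      simp only [map_sub, map_sum, map_smul, smul_eq_mul]
    rw [e]
    refine (hC _).trans ?_
    rw [smul_apply, NNReal.smul_def, smul_eq_mul, mul_assoc]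
    gcongr
    apply Seminorm.finset_sup_apply_le
    · have := Finset.sum_nonneg (s := s) fun m _ => hA0 m
      positivity
    · intro m hm
      refine (hA m h u (hh ▸ hb) hu).trans ?_
      rw [hh]
      gcongr
      exact Finset.single_le_sum (f := A) (fun m _ => hA0 m) hm
  have hD : HasFDerivAt (fun a : Fin d → ℂ => f (gS a)) D a := by
    rw [hasFDerivAt_iff_isLittleO_nhds_zero]
    have h1 : (fun b : Fin d → ℂ => f (gS (a + b)) - f (gS a) - D b) =O[nhds 0]
        (fun b => ‖b‖ ^ 2) := by
      apply Asymptotics.IsBigO.of_bound (C * ∑ m ∈ s, A m)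
      filter_upwards [Metric.ball_mem_nhds (0 : Fin d → ℂ) one_pos] with b hb
      have := key b (by simpa using (le_of_lt (mem_ball_zero_iff.1 hb)))
      simpa using this
    refine h1.trans_isLittleO ?_
    exact (Asymptotics.isLittleO_norm_pow_id (E' := Fin d → ℂ) one_lt_two)
  exact hD.differentiableAt

def toC {d : ℕ} (X : (Fin d → ℝ) × (Fin d → ℝ)) : Fin d → ℂ :=
  fun i => (X.1 i : ℂ) - Complex.I * (X.2 i : ℂ)

def toR {d : ℕ} (v : Fin d → ℂ) : (Fin d → ℝ) × (Fin d → ℝ) :=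
  (fun i => (v i).re, -fun i => (v i).im)

theorem vol_haar (d : ℕ) :
    (volume : Measure ((Fin d → ℝ) × (Fin d → ℝ))).IsAddHaarMeasure :=
  Measure.prod.instIsAddHaarMeasure (volume : Measure (Fin d → ℝ))
    (volume : Measure (Fin d → ℝ))

theorem toR_mp (d : ℕ) : MeasurePreserving (toR (d := d)) := by
  have h1 : MeasurePreserving (fun (v : Fin d → ℂ) (i : Fin d) =>
      Complex.measurableEquivRealProd (v i)) :=
    volume_preserving_pi fun _ => Complex.volume_preserving_equiv_real_prod
  have h2 := volume_measurePreserving_arrowProdEquivProdArrow ℝ ℝ (Fin d)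
  have h3 : MeasurePreserving (Prod.map (id : (Fin d → ℝ) → (Fin d → ℝ))
      (Neg.neg : (Fin d → ℝ) → (Fin d → ℝ))) :=
    (MeasurePreserving.id (volume : Measure (Fin d → ℝ))).prod
      (Measure.measurePreserving_neg (volume : Measure (Fin d → ℝ)))
  exact h3.comp (h2.comp h1)

theorem toR_norm {d : ℕ} (v : Fin d → ℂ) : ‖toR v‖ ≤ ‖v‖ := by
  rw [Prod.norm_def]
  apply max_le
  · rw [pi_norm_le_iff_of_nonneg (norm_nonneg _)]
    intro i
    exact (Complex.abs_re_le_norm _).trans (norm_le_pi_norm v i)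
  · rw [toR, norm_neg, pi_norm_le_iff_of_nonneg (norm_nonneg _)]
    intro i
    exact (Complex.abs_im_le_norm _).trans (norm_le_pi_norm v i)

theorem toC_add_toR {d : ℕ} (X : (Fin d → ℝ) × (Fin d → ℝ)) (v : Fin d → ℂ) :
    toC (X + toR v) = toC X + v := by
  funext i
  simp only [toC, toR, Prod.fst_add, Prod.snd_add, Pi.add_apply, Pi.neg_apply]
  push_cast
  conv_rhs => rw [← Complex.re_add_im (v i)]
  ring

def kap (d : ℕ) : ℝ := (2 * Real.pi) ^ (-(d : ℝ) / 2) * Real.pi ^ (-(d : ℝ) / 4)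

theorem G_eq {d : ℕ} {f : SchwartzMap (Fin d → ℝ) ℂ →L[ℂ] ℂ}
    {G : (Fin d → ℝ) × (Fin d → ℝ) → ℂ}
    (hG : ∀ (x ξ : Fin d → ℝ) (ψ : SchwartzMap (Fin d → ℝ) ℂ),
          (∀ y, ψ y = (starRingEnd ℂ) (gaussianWindow d (y - x)) *
              Complex.exp (-Complex.I * ((∑ i, y i * ξ i : ℝ) : ℂ))) →
          G (x, ξ) = (((2 * Real.pi) ^ (-(d : ℝ) / 2) : ℝ) : ℂ) * f ψ)
    (X : (Fin d → ℝ) × (Fin d → ℝ)) :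
    G X = (kap d : ℂ) * Complex.exp (-((∑ i, X.1 i ^ 2 : ℝ) : ℂ) / 2) * f (gS (toC X)) := by
  obtain ⟨x, ξ⟩ := X
  rw [hG x ξ ((((Real.pi ^ (-(d : ℝ) / 4) : ℝ) : ℂ) *
    Complex.exp (-((∑ i, x i ^ 2 : ℝ) : ℂ) / 2)) • gS (toC (x, ξ)))]
  · rw [map_smul, smul_eq_mul, kap]
    push_cast
    ring
  · intro y
    rw [smul_apply, smul_eq_mul, gS_apply, gaussianWindow, map_mul, Complex.conj_ofReal,
      ← Complex.exp_conj, mul_assoc, mul_assoc, ← Complex.exp_add, ← Complex.exp_add]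
    congr 2
    have : (starRingEnd ℂ) (-((∑ i, (y - x) i ^ 2 : ℝ) : ℂ) / 2) =
        -((∑ i, (y - x) i ^ 2 : ℝ) : ℂ) / 2 := by
      rw [map_div₀, map_neg, Complex.conj_ofReal,
        show (starRingEnd ℂ) (2 : ℂ) = 2 from map_ofNat _ 2]
    rw [this, quad, linL_apply]
    push_cast
    simp only [toC, Pi.sub_apply, Complex.ofReal_sub, neg_div, Finset.sum_div, Finset.mul_sum,
      ← Finset.sum_neg_distrib, ← Finset.sum_add_distrib]
    exact Finset.sum_congr rfl fun i _ => by ring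

theorem main_q (d : ℕ) {q : ℝ} (hq : 0 < q) (R : ℝ) (hR : 0 < R)
    (f : SchwartzMap (Fin d → ℝ) ℂ →L[ℂ] ℂ)
    (G : (Fin d → ℝ) × (Fin d → ℝ) → ℂ)
    (hG : ∀ (x ξ : Fin d → ℝ) (ψ : SchwartzMap (Fin d → ℝ) ℂ),
          (∀ y, ψ y = (starRingEnd ℂ) (gaussianWindow d (y - x)) *
              Complex.exp (-Complex.I * ((∑ i, y i * ξ i : ℝ) : ℂ))) →
          G (x, ξ) = (((2 * Real.pi) ^ (-(d : ℝ) / 2) : ℝ) : ℂ) * f ψ)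
    (X₀ : (Fin d → ℝ) × (Fin d → ℝ)) :
    ‖G X₀‖ₑ ^ q * volume (Metric.ball (0 : Fin d → ℂ) R) ≤
      ENNReal.ofReal (Real.exp (d * R ^ 2 / 2)) ^ q *
        ∫⁻ X in Metric.ball X₀ R, ‖G X‖ₑ ^ q := by
  have hGe := G_eq hG
  have hF := F_diff f
  have hGc : Continuous G := by
    have : G = fun X => (kap d : ℂ) * Complex.exp (-((∑ i, X.1 i ^ 2 : ℝ) : ℂ) / 2) *
      f (gS (toC X)) := funext hGe
    rw [this]
    have hc : Continuous (toC (d := d)) := by unfold toC; fun_prop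
    have := hF.continuous.comp hc
    refine Continuous.mul (by fun_prop) this
  set H : (Fin d → ℂ) → ℂ := fun w => (kap d : ℂ) *
    Complex.exp (((∑ i, X₀.1 i ^ 2 : ℝ) : ℂ) / 2 - ∑ i, w i * (X₀.1 i : ℂ)) * f (gS w) with hHdef
  have hH : Differentiable ℂ H := by
    refine Differentiable.mul (by fun_prop) hF
  have hHG : ∀ X, ‖H (toC X)‖ = Real.exp ((∑ i, (X.1 i - X₀.1 i) ^ 2) / 2) * ‖G X‖ := by
    intro X
    rw [hGe]
    simp only [hHdef, norm_mul, Complex.norm_exp]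
    have h1 : (((∑ i, X₀.1 i ^ 2 : ℝ) : ℂ) / 2 - ∑ i, toC X i * (X₀.1 i : ℂ)).re =
        (∑ i, (X.1 i - X₀.1 i) ^ 2) / 2 + (-((∑ i, X.1 i ^ 2 : ℝ) : ℂ) / 2).re := by
      have e1 : (-((∑ i, X.1 i ^ 2 : ℝ) : ℂ) / 2).re = -(∑ i, X.1 i ^ 2) / 2 := by
        rw [show (-((∑ i, X.1 i ^ 2 : ℝ) : ℂ) / 2) = ((-(∑ i, X.1 i ^ 2) / 2 : ℝ) : ℂ) by
          push_cast; rfl, Complex.ofReal_re]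
      have e2 : (((∑ i, X₀.1 i ^ 2 : ℝ) : ℂ) / 2).re = (∑ i, X₀.1 i ^ 2) / 2 := by
        rw [show (((∑ i, X₀.1 i ^ 2 : ℝ) : ℂ) / 2) = (((∑ i, X₀.1 i ^ 2) / 2 : ℝ) : ℂ) by
          push_cast; rfl, Complex.ofReal_re]
      rw [Complex.sub_re, e1, e2, Complex.re_sum]
      have e3 : ∀ i, (toC X i * (X₀.1 i : ℂ)).re = X.1 i * X₀.1 i := by
        intro i; simp [toC]
      simp only [e3, neg_div, Finset.sum_div, ← Finset.sum_neg_distrib,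
        ← Finset.sum_sub_distrib, ← Finset.sum_add_distrib]
      exact Finset.sum_congr rfl fun i _ => by ring
    rw [h1, Real.exp_add]
    ring
  have hmean := aux_mean hq hH (toC X₀) R
  have h0 : ‖H (toC X₀)‖ₑ = ‖G X₀‖ₑ := by
    rw [← ofReal_norm, ← ofReal_norm, hHG]; simp
  rw [h0] at hmean
  refine hmean.trans ?_
  set K : ℝ≥0∞ := ENNReal.ofReal (Real.exp (d * R ^ 2 / 2)) with hK
  have hKt : K ^ q ≠ ⊤ := ENNReal.rpow_ne_top_of_nonneg hq.le ENNReal.ofReal_ne_top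
  have hpt : ∀ v ∈ Metric.ball (0 : Fin d → ℂ) R,
      ‖H (toC X₀ + v)‖ₑ ^ q ≤ K ^ q * ‖G (X₀ + toR v)‖ₑ ^ q := by
    intro v hv
    rw [← ENNReal.mul_rpow_of_nonneg _ _ hq.le]
    apply ENNReal.rpow_le_rpow _ hq.le
    rw [← toC_add_toR, ← ofReal_norm, ← ofReal_norm, hK,
      ← ENNReal.ofReal_mul (Real.exp_pos _).le, hHG]
    apply ENNReal.ofReal_le_ofReal
    gcongr
    have hv' : ‖toR v‖ ≤ R := (toR_norm v).trans (by simpa using (mem_ball_zero_iff.1 hv).le)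
    calc ∑ i, ((X₀ + toR v).1 i - X₀.1 i) ^ 2 ≤ ∑ i : Fin d, R ^ 2 := by
          apply Finset.sum_le_sum
          intro i _
          have : (X₀ + toR v).1 i - X₀.1 i = (toR v).1 i := by simp
          rw [this, ← sq_abs]
          gcongr
          exact (norm_le_pi_norm (toR v).1 i).trans ((norm_fst_le _).trans hv')
      _ = d * R ^ 2 := by simp
  have hGm : Measurable (fun X => ‖G X‖ₑ ^ q) := hGc.measurable.enorm.pow_const q
  calc ∫⁻ v in Metric.ball (0 : Fin d → ℂ) R, ‖H (toC X₀ + v)‖ₑ ^ q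
      ≤ ∫⁻ v in Metric.ball (0 : Fin d → ℂ) R, K ^ q * ‖G (X₀ + toR v)‖ₑ ^ q :=
        setLIntegral_mono' Metric.isOpen_ball.measurableSet hpt
    _ = K ^ q * ∫⁻ v in Metric.ball (0 : Fin d → ℂ) R, ‖G (X₀ + toR v)‖ₑ ^ q :=
        lintegral_const_mul' _ _ hKt
    _ ≤ K ^ q * ∫⁻ v in (fun v => X₀ + toR v) ⁻¹' (Metric.ball X₀ R),
        ‖G (X₀ + toR v)‖ₑ ^ q := by
        gcongr
        intro v hv
        simp only [Set.mem_preimage, Metric.mem_ball, dist_self_add_left]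
        exact (toR_norm v).trans_lt (mem_ball_zero_iff.1 hv)
    _ = _ := by
        have := vol_haar d
        have hmp : MeasurePreserving (fun v : Fin d → ℂ => X₀ + toR v) :=
          (measurePreserving_add_left volume X₀).comp (toR_mp d)
        rw [(hmp.restrict_preimage
          (s := Metric.ball X₀ R) Metric.isOpen_ball.measurableSet).lintegral_comp hGm]

/-- Let `p ∈ (0,∞]`, `R > 0` and `φ₀` the Gaussian. There is a constant
`C > 0`, independent of the center `X₀ ∈ ℝ^{2d}` and of the tempered distribution `f`,
such that `|V_{φ₀} f(X₀)| ≤ C ‖V_{φ₀} f‖_{L^p(B_R(X₀))}`. Here the tempered distribution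
`f` is a continuous linear functional on Schwartz space, and `G = V_{φ₀} f` is
characterized by `G(x,ξ) = (2π)^{−d/2} f(conj(φ₀(·−x)) e^{−i⟨·,ξ⟩})`. -/
theorem stmt10 (d : ℕ) (p : ℝ≥0∞) (hp : 0 < p) (R : ℝ) (hR : 0 < R) :
    ∃ C : ℝ≥0∞, 0 < C ∧ C < ⊤ ∧
      ∀ (f : SchwartzMap (Fin d → ℝ) ℂ →L[ℂ] ℂ)
        (G : (Fin d → ℝ) × (Fin d → ℝ) → ℂ),
        (∀ (x ξ : Fin d → ℝ) (ψ : SchwartzMap (Fin d → ℝ) ℂ),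
          (∀ y, ψ y = (starRingEnd ℂ) (gaussianWindow d (y - x)) *
              Complex.exp (-Complex.I * ((∑ i, y i * ξ i : ℝ) : ℂ))) →
          G (x, ξ) = (((2 * Real.pi) ^ (-(d : ℝ) / 2) : ℝ) : ℂ) * f ψ) →
        ∀ X₀ : (Fin d → ℝ) × (Fin d → ℝ),
          (‖G X₀‖₊ : ℝ≥0∞)
            ≤ C * eLpNorm G p
                ((volume : Measure ((Fin d → ℝ) × (Fin d → ℝ))).restrict
                  (Metric.ball X₀ R)) := by
  -- the volume of the polydisc
  set V : ℝ≥0∞ := volume (Metric.ball (0 : Fin d → ℂ) R) with hV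
  have hV0 : V ≠ 0 := (Metric.measure_ball_pos volume _ hR).ne'
  have hVt : V ≠ ⊤ := measure_ball_lt_top.ne
  set K : ℝ≥0∞ := ENNReal.ofReal (Real.exp (d * R ^ 2 / 2)) with hK
  have hK0 : K ≠ 0 := by simp [hK, Real.exp_pos]
  have hKt : K ≠ ⊤ := ENNReal.ofReal_ne_top
  have hdiv : ∀ {a b : ℝ≥0∞}, a * V ≤ b → a ≤ b * V⁻¹ := by
    intro a b h
    rw [← div_eq_mul_inv]
    exact (ENNReal.le_div_iff_mul_le (Or.inl hV0) (Or.inl hVt)).2 h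
  by_cases hpt : p = ⊤
  · subst hpt
    set W : ℝ≥0∞ := volume (Metric.ball (0 : (Fin d → ℝ) × (Fin d → ℝ)) R) with hW
    have hW0 : W ≠ 0 := (Metric.measure_ball_pos volume _ hR).ne'
    have hWt : W ≠ ⊤ := measure_ball_lt_top.ne
    have hVi0 : V⁻¹ ≠ 0 := ENNReal.inv_ne_zero.2 hVt
    have hVit : V⁻¹ ≠ ⊤ := ENNReal.inv_ne_top.2 hV0
    refine ⟨K * W * V⁻¹, pos_iff_ne_zero.2 (mul_ne_zero (mul_ne_zero hK0 hW0) hVi0),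
      (ENNReal.mul_ne_top (ENNReal.mul_ne_top hKt hWt) hVit).lt_top, ?_⟩
    intro f G hG X₀
    have h := main_q d one_pos R hR f G hG X₀
    simp only [ENNReal.rpow_one] at h
    have h2 : ∫⁻ X in Metric.ball X₀ R, ‖G X‖ₑ ≤
        eLpNorm G ⊤ (volume.restrict (Metric.ball X₀ R)) * W := by
      have := vol_haar d
      have hWX : W = volume (Metric.ball X₀ R) := by
        rw [hW, Measure.addHaar_ball_center volume X₀]
      rw [hWX, eLpNorm_exponent_top]
      calc _ ≤ ∫⁻ X in Metric.ball X₀ R,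
            eLpNormEssSup G (volume.restrict (Metric.ball X₀ R)) :=
            lintegral_mono_ae (enorm_ae_le_eLpNormEssSup G _)
        _ = _ := by simp
    calc (‖G X₀‖₊ : ℝ≥0∞) ≤ (K * ∫⁻ X in Metric.ball X₀ R, ‖G X‖ₑ) * V⁻¹ := hdiv h
      _ ≤ (K * (eLpNorm G ⊤ (volume.restrict (Metric.ball X₀ R)) * W)) * V⁻¹ := by gcongr
      _ = _ := by ring
  · set q : ℝ := p.toReal with hqdef
    have hq : 0 < q := ENNReal.toReal_pos hp.ne' hpt
    have hVi0 : V⁻¹ ^ (1 / q) ≠ 0 :=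
      (ENNReal.rpow_pos (ENNReal.inv_pos.2 hVt) (ENNReal.inv_ne_top.2 hV0)).ne'
    have hVit : V⁻¹ ^ (1 / q) ≠ ⊤ :=
      ENNReal.rpow_ne_top_of_nonneg (by positivity) (ENNReal.inv_ne_top.2 hV0)
    refine ⟨K * V⁻¹ ^ (1 / q), pos_iff_ne_zero.2 (mul_ne_zero hK0 hVi0),
      (ENNReal.mul_ne_top hKt hVit).lt_top, ?_⟩
    intro f G hG X₀
    have h := hdiv (main_q d hq R hR f G hG X₀)
    rw [eLpNorm_eq_lintegral_rpow_enorm_toReal hp.ne' hpt, ← hqdef]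
    have h3 := ENNReal.rpow_le_rpow h (by positivity : 0 ≤ 1 / q)
    rw [ENNReal.mul_rpow_of_nonneg _ _ (by positivity),
      ENNReal.mul_rpow_of_nonneg _ _ (by positivity), ← ENNReal.rpow_mul, ← ENNReal.rpow_mul,
      mul_one_div_cancel hq.ne', ENNReal.rpow_one, ENNReal.rpow_one] at h3
    calc (‖G X₀‖₊ : ℝ≥0∞) ≤ _ := h3
      _ = _ := by ring
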